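/- arXiv:2004.04685 — 3 statements merged into one kernel-verified Lean document; each statement's English description precedes it below -/
import Mathlib

section
/- Let V be a symmetric positive semidefinite n x n matrix, R a symmetric positive definite p x p matrix, Qbar a symmetric positive semidefinite n x n matrix, and A, B real matrices of sizes n x n and n x p. Define V_minus = A' V A + Qbar - A' V B (B' V B + R)^{-1} B' V A and K = -(B' V B + R)^{-1} B' V A. Then B' V B + R is invertible; for all x in R^n and u in R^p, u' (B' V B + R) u + 2 x' A' V B u + x' (A' V A + Qbar) x >= x' V_minus x, with equality if and only if u = K x; and V_minus is symmetric positive semidefinite. -/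
open Matrix

/-- Completing the square in `u`, with `K` a solution of `S * K = -Gᵀ`. -/
lemma dotProduct_mulVec_complete_square {m k α : Type*} [Fintype m] [Fintype k] [CommRing α]
    {S : Matrix k k α} (hS : Sᵀ = S) {G : Matrix m k α} {K : Matrix k m α}
    (hK : S * K = -Gᵀ) (W : Matrix m m α) (x : m → α) (u : k → α) :
    u ⬝ᵥ S *ᵥ u + 2 * (x ⬝ᵥ G *ᵥ u) + x ⬝ᵥ W *ᵥ x =
      (u - K *ᵥ x) ⬝ᵥ S *ᵥ (u - K *ᵥ x) + x ⬝ᵥ (W + G * K) *ᵥ x := by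
  obtain ⟨v, rfl⟩ : ∃ v, u = v + K *ᵥ x := ⟨u - K *ᵥ x, by simp⟩
  have hG : ∀ w : k → α, x ⬝ᵥ G *ᵥ w = w ⬝ᵥ Gᵀ *ᵥ x := fun w => by
    rw [dotProduct_mulVec, dotProduct_comm, mulVec_transpose]
  have hSK : S *ᵥ (K *ᵥ x) = -(Gᵀ *ᵥ x) := by rw [mulVec_mulVec, hK, neg_mulVec]
  have hSv : (K *ᵥ x) ⬝ᵥ S *ᵥ v = -(v ⬝ᵥ Gᵀ *ᵥ x) := by
    rw [dotProduct_mulVec, ← mulVec_transpose, hS, hSK, dotProduct_comm, dotProduct_neg]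
  simp only [add_sub_cancel_right, add_mulVec, ← mulVec_mulVec, mulVec_add, dotProduct_add,
    add_dotProduct, hG, hSK, hSv, dotProduct_neg]
  ring

/-- The Riccati update in closed-loop (Joseph) form. -/
lemma riccati_eq_closedLoop {m k α : Type*} [Fintype m] [Fintype k] [CommRing α]
    (V Q A : Matrix m m α) (R : Matrix k k α) (B : Matrix m k α) {K : Matrix k m α}
    (hK : (Bᵀ * V * B + R) * K = -(Bᵀ * V * A)) :
    Aᵀ * V * A + Q + Aᵀ * V * B * K =
      (A + B * K)ᵀ * V * (A + B * K) + Kᵀ * R * K + Q := by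
  have h : Kᵀ * (Bᵀ * V * A) + Kᵀ * (Bᵀ * V * B * K) + Kᵀ * (R * K) = 0 := by
    rw [add_assoc, ← Matrix.mul_add, ← Matrix.add_mul, hK, Matrix.mul_neg, add_neg_cancel]
  simp only [transpose_add, transpose_mul, Matrix.add_mul, Matrix.mul_add, Matrix.mul_assoc] at h ⊢
  rw [← sub_eq_zero, ← neg_eq_zero, ← h]
  abel

/- STATEMENT 6: one-step Riccati minimization.  For V ⪰ 0 symmetric (n×n), R ≻ 0 symmetric
(p×p), Qbar ⪰ 0 symmetric (n×n), and A (n×n), B (n×p), define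
V₋ = AᵀVA + Qbar − AᵀVB(BᵀVB+R)⁻¹BᵀVA and K = −(BᵀVB+R)⁻¹BᵀVA.  Then BᵀVB + R is invertible;
for all x ∈ ℝⁿ, u ∈ ℝᵖ the quadratic u'(BᵀVB+R)u + 2x'AᵀVBu + x'(AᵀVA+Qbar)x is at least
x'V₋x, with equality iff u = Kx; and V₋ is (symmetric) positive semidefinite. -/
theorem stmt6 {n p : ℕ}
    (V Qbar : Matrix (Fin n) (Fin n) ℝ) (R : Matrix (Fin p) (Fin p) ℝ)
    (hV : V.PosSemidef) (hQbar : Qbar.PosSemidef) (hR : R.PosDef)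
    (A : Matrix (Fin n) (Fin n) ℝ) (B : Matrix (Fin n) (Fin p) ℝ)
    (Vm : Matrix (Fin n) (Fin n) ℝ)
    (hVm : Vm = Aᵀ * V * A + Qbar - Aᵀ * V * B * (Bᵀ * V * B + R)⁻¹ * (Bᵀ * V * A))
    (K : Matrix (Fin p) (Fin n) ℝ)
    (hK : K = -((Bᵀ * V * B + R)⁻¹ * (Bᵀ * V * A))) :
    IsUnit (Bᵀ * V * B + R) ∧
    (∀ (x : Fin n → ℝ) (u : Fin p → ℝ),
      x ⬝ᵥ Vm.mulVec x ≤
        u ⬝ᵥ (Bᵀ * V * B + R).mulVec u + 2 * (x ⬝ᵥ (Aᵀ * V * B).mulVec u)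
          + x ⬝ᵥ (Aᵀ * V * A + Qbar).mulVec x) ∧
    (∀ (x : Fin n → ℝ) (u : Fin p → ℝ),
      (u ⬝ᵥ (Bᵀ * V * B + R).mulVec u + 2 * (x ⬝ᵥ (Aᵀ * V * B).mulVec u)
          + x ⬝ᵥ (Aᵀ * V * A + Qbar).mulVec x = x ⬝ᵥ Vm.mulVec x)
        ↔ u = K.mulVec x) ∧
    Vm.PosSemidef := by
  have hVt : Vᵀ = V := by simpa using hV.1.eq
  have hS : (Bᵀ * V * B + R).PosDef := by
    simpa using PosDef.posSemidef_add (hV.conjTranspose_mul_mul_same B) hR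
  have hSt : (Bᵀ * V * B + R)ᵀ = Bᵀ * V * B + R := by simpa using hS.1.eq
  have hSK : (Bᵀ * V * B + R) * K = -(Bᵀ * V * A) := by
    rw [hK, Matrix.mul_neg,
      mul_nonsing_inv_cancel_left _ _ ((isUnit_iff_isUnit_det _).mp hS.isUnit)]
  have hSG : (Bᵀ * V * B + R) * K = -(Aᵀ * V * B)ᵀ := by
    rw [hSK]; simp [hVt, Matrix.mul_assoc]
  have hVmK : Vm = Aᵀ * V * A + Qbar + Aᵀ * V * B * K := by
    simp only [hVm, hK, Matrix.mul_neg, Matrix.mul_assoc, sub_eq_add_neg]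
  have hsq := dotProduct_mulVec_complete_square hSt hSG (Aᵀ * V * A + Qbar)
  rw [← hVmK] at hsq
  refine ⟨hS.isUnit, fun x u => ?_, fun x u => ?_, ?_⟩
  · rw [hsq]
    simpa using hS.posSemidef.dotProduct_mulVec_nonneg (u - K *ᵥ x)
  · rw [hsq, add_eq_right]
    refine ⟨fun h => ?_, fun h => by simp [h]⟩
    by_contra hne
    exact (hS.dotProduct_mulVec_pos (sub_ne_zero.mpr hne)).ne' (by simpa using h)
  · rw [hVmK, riccati_eq_closedLoop V Qbar A R B hSK]
    simpa only [conjTranspose_eq_transpose_of_trivial] using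
      ((hV.conjTranspose_mul_mul_same (A + B * K)).add
        (hR.posSemidef.conjTranspose_mul_mul_same K)).add hQbar
end

section
/- Let U be a nonempty set, J, J_R : U -> R, ebar in R, and let u* : [0, infinity) -> U be such that for every mu >= 0 and every u in U, J(u*(mu)) + mu*J_R(u*(mu)) <= J(u) + mu*J_R(u). Assume the map mu -> J_R(u*(mu)) is continuous on [0, infinity), and that the set S = { mu >= 0 : J_R(u*(mu)) <= ebar } is nonempty; let mu* = inf S. Then J_R(u*(mu*)) <= ebar, mu* * (J_R(u*(mu*)) - ebar) = 0, and u*(mu*) is optimal for the constrained problem: J(u*(mu*)) = inf{ J(u) : u in U, J_R(u) <= ebar }. -/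
/-- A minimizer of the Lagrangian which is feasible and satisfies complementary slackness is
optimal for the constrained problem. -/
theorem isLeast_of_lagrangian_le_of_slackness {U : Type*} {J JR : U → ℝ} {ebar μ : ℝ} {v : U}
    (hμ : 0 ≤ μ) (hmin : ∀ u, J v + μ * JR v ≤ J u + μ * JR u) (hfeas : JR v ≤ ebar)
    (hslack : μ * (JR v - ebar) = 0) :
    IsLeast {y : ℝ | ∃ u : U, JR u ≤ ebar ∧ J u = y} (J v) := by
  refine ⟨⟨v, hfeas, rfl⟩, ?_⟩
  rintro _ ⟨u, hu, rfl⟩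
  linarith [hmin u, mul_le_mul_of_nonneg_left hu hμ]

/-- The infimum of a nonempty sublevel set in `[0, ∞)` of a continuous function belongs to it. -/
theorem sInf_sublevel_mem {f : ℝ → ℝ} {c : ℝ} (hf : ContinuousOn f (Set.Ici 0))
    (hne : {x : ℝ | 0 ≤ x ∧ f x ≤ c}.Nonempty) :
    sInf {x : ℝ | 0 ≤ x ∧ f x ≤ c} ∈ {x : ℝ | 0 ≤ x ∧ f x ≤ c} :=
  (hf.preimage_isClosed_of_isClosed isClosed_Ici isClosed_Iic).csInf_mem hne
    ⟨0, fun _ hx => hx.1⟩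

/-- The infimum of a sublevel set in `[0, ∞)` of a continuous function, when positive, is not
in the strict sublevel set. -/
theorem le_of_sInf_sublevel_pos {f : ℝ → ℝ} {c : ℝ} (hf : ContinuousOn f (Set.Ici 0))
    (hpos : 0 < sInf {x : ℝ | 0 ≤ x ∧ f x ≤ c}) :
    c ≤ f (sInf {x : ℝ | 0 ≤ x ∧ f x ≤ c}) := by
  by_contra! hlt
  have hev := (hf.continuousAt (Ici_mem_nhds hpos)).eventually (gt_mem_nhds hlt)
  obtain ⟨x, hx, hx0, hxs⟩ :=
    ((hev.filter_mono nhdsWithin_le_nhds).and (Ioo_mem_nhdsLT hpos)).exists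
  exact hxs.not_ge (csInf_le ⟨0, fun _ hy => hy.1⟩ ⟨hx0.le, hx.le⟩)

/- STATEMENT 12: recovery of a primal-optimal solution.  For each μ ≥ 0, u*(μ) minimizes the
Lagrangian L(u, μ) = J(u) + μ*(J_R(u) - ebar) over U (equivalently J(u) + μ*J_R(u)).  Assume
μ ↦ J_R(u*(μ)) is continuous on [0, ∞) and S = { μ ≥ 0 : J_R(u*(μ)) ≤ ebar } is nonempty, and
let μ* = inf S.  Then u*(μ*) is feasible (J_R(u*(μ*)) ≤ ebar), complementary slackness holds
(μ* * (J_R(u*(μ*)) - ebar) = 0), and u*(μ*) is optimal for the constrained problem: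
J(u*(μ*)) = inf{ J(u) : u ∈ U, J_R(u) ≤ ebar } (the infimum being attained at u*(μ*),
which is expressed by IsLeast). -/
theorem stmt12 {U : Type*} [Nonempty U] (J JR : U → ℝ) (ebar : ℝ)
    (ustar : ℝ → U)
    (hopt : ∀ μ : ℝ, 0 ≤ μ → ∀ u : U,
      J (ustar μ) + μ * JR (ustar μ) ≤ J u + μ * JR u)
    (hcont : ContinuousOn (fun μ => JR (ustar μ)) (Set.Ici (0 : ℝ)))
    (hne : {μ : ℝ | 0 ≤ μ ∧ JR (ustar μ) ≤ ebar}.Nonempty)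
    (mustar : ℝ) (hmustar : mustar = sInf {μ : ℝ | 0 ≤ μ ∧ JR (ustar μ) ≤ ebar}) :
    JR (ustar mustar) ≤ ebar ∧
    mustar * (JR (ustar mustar) - ebar) = 0 ∧
    IsLeast {y : ℝ | ∃ u : U, JR u ≤ ebar ∧ J u = y} (J (ustar mustar)) := by
  subst hmustar
  obtain ⟨hnonneg, hfeas⟩ := sInf_sublevel_mem hcont hne
  have hslack : sInf {μ : ℝ | 0 ≤ μ ∧ JR (ustar μ) ≤ ebar} *
      (JR (ustar (sInf {μ : ℝ | 0 ≤ μ ∧ JR (ustar μ) ≤ ebar})) - ebar) = 0 := by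
    rcases hnonneg.eq_or_lt with hzero | hpos
    · rw [← hzero, zero_mul]
    · rw [hfeas.antisymm (le_of_sInf_sublevel_pos hcont hpos), sub_self, mul_zero]
  exact ⟨hfeas, hslack,
    isLeast_of_lagrangian_le_of_slackness hnonneg (hopt _ hnonneg) hfeas hslack⟩
end

section
/- Let U be a nonempty set, J, J_R : U -> R, ebar in R, and let u* : [0, infinity) -> U be such that for every mu >= 0 and every u in U, J(u*(mu)) + mu*J_R(u*(mu)) <= J(u) + mu*J_R(u). Suppose Slater's condition holds: there exists udagger in U with J_R(udagger) < ebar. Then there exists mu >= 0 with J_R(u*(mu)) < ebar; in particular the set { mu >= 0 : J_R(u*(mu)) <= ebar } is nonempty and mu* = inf{ mu >= 0 : J_R(u*(mu)) <= ebar } is finite. -/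
/- STATEMENT 13: Slater's condition implies finiteness of the optimal multiplier.  For each
μ ≥ 0, u*(μ) minimizes the Lagrangian L(u, μ) = J(u) + μ*(J_R(u) - ebar) over U (equivalently
J(u) + μ*J_R(u)).  If there exists u† ∈ U with J_R(u†) < ebar (Slater's condition), then there
exists μ ≥ 0 with J_R(u*(μ)) < ebar; in particular the set { μ ≥ 0 : J_R(u*(μ)) ≤ ebar } is
nonempty, and μ* = inf{ μ ≥ 0 : J_R(u*(μ)) ≤ ebar } is a (finite) real number bounded above by
any such μ† at which the constraint holds strictly. -/
theorem stmt13 {U : Type*} [Nonempty U] (J JR : U → ℝ) (ebar : ℝ)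
    (ustar : ℝ → U)
    (hopt : ∀ μ : ℝ, 0 ≤ μ → ∀ u : U,
      J (ustar μ) + μ * JR (ustar μ) ≤ J u + μ * JR u)
    (hslater : ∃ udag : U, JR udag < ebar) :
    (∃ μ : ℝ, 0 ≤ μ ∧ JR (ustar μ) < ebar) ∧
    {μ : ℝ | 0 ≤ μ ∧ JR (ustar μ) ≤ ebar}.Nonempty ∧
    ∃ μdag : ℝ, 0 ≤ μdag ∧ JR (ustar μdag) < ebar ∧
      sInf {μ : ℝ | 0 ≤ μ ∧ JR (ustar μ) ≤ ebar} ≤ μdag := by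
  obtain ⟨udag, hu⟩ := hslater
  have hd : 0 < ebar - JR udag := sub_pos.mpr hu
  have h0 : ∀ u, J (ustar 0) ≤ J u := by simpa using hopt 0 le_rfl
  obtain ⟨μ, hμ, hlt⟩ : ∃ μ : ℝ, 0 ≤ μ ∧ JR (ustar μ) < ebar := by
    set μ := (J udag - J (ustar 0) + 1) / (ebar - JR udag)
    have hμ : 0 ≤ μ := div_nonneg (by linarith [h0 udag]) hd.le
    have hmul : μ * (ebar - JR udag) = J udag - J (ustar 0) + 1 := div_mul_cancel₀ _ hd.ne'
    refine ⟨μ, hμ, ?_⟩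
    by_contra! hge
    linarith [hopt μ hμ udag, h0 (ustar μ), mul_le_mul_of_nonneg_left hge hμ]
  exact ⟨⟨μ, hμ, hlt⟩, ⟨μ, hμ, hlt.le⟩, μ, hμ, hlt, csInf_le ⟨0, fun _ h => h.1⟩ ⟨hμ, hlt.le⟩⟩
end
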